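/- Let p be a complex number and let r be a positive odd integer. Then for every positive integer n, \(\sum_{k=0}^{n} \binom{2n}{n+k} v_{k}^{2r} = 2^{2r-1}\binom{2n}{n} + (p^{2}+4)^{n} \sum_{i=0}^{r-1} (-1)^{in} \binom{2r}{i} u_{r-i}^{2n}\). -/

import Mathlib

/-- Generalized Fibonacci sequence: `u 0 = 0`, `u 1 = 1`, `u (n+2) = p * u (n+1) + u n`. -/
def genFib (p : ℂ) : ℕ → ℂ
  | 0 => 0
  | 1 => 1
  | n + 2 => p * genFib p (n + 1) + genFib p n

/-- Generalized Lucas sequence: `v 0 = 2`, `v 1 = p`, `v (n+2) = p * v (n+1) + v n`. -/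
def genLucas (p : ℂ) : ℕ → ℂ
  | 0 => 2
  | 1 => p
  | n + 2 => p * genLucas p (n + 1) + genLucas p n

theorem genLucas_eq_pow_add_pow {a b p : ℂ} (hp : a + b = p) (hab : a * b = -1) (n : ℕ) :
    genLucas p n = a ^ n + b ^ n := by
  induction n using Nat.twoStepInduction with
  | zero => norm_num [genLucas]
  | one => simp [genLucas, hp]
  | more n h0 h1 =>
    rw [genLucas, h0, h1, ← hp]
    linear_combination (a ^ n + b ^ n) * hab

theorem sub_mul_genFib {a b p : ℂ} (hp : a + b = p) (hab : a * b = -1) (n : ℕ) :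
    (a - b) * genFib p n = a ^ n - b ^ n := by
  induction n using Nat.twoStepInduction with
  | zero => simp [genFib]
  | one => simp [genFib]
  | more n h0 h1 =>
    subst hp
    rw [genFib]
    linear_combination (a + b) * h1 + h0 + (a ^ n - b ^ n) * hab

theorem exists_add_eq_and_mul_eq_neg_one (p : ℂ) : ∃ a b : ℂ, a + b = p ∧ a * b = -1 := by
  obtain ⟨s, hs⟩ := IsAlgClosed.exists_pow_nat_eq (p ^ 2 + 4) (n := 2) (by norm_num)
  exact ⟨(p + s) / 2, (p - s) / 2, by ring, by linear_combination (-1 / 4 : ℂ) * hs⟩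

/-- The symmetric expansion of `(c + 2 + c⁻¹) ^ n`, with `d` in the role of `c⁻¹`. -/
theorem sum_choose_mul_pow_add_pow {R : Type*} [CommRing R] {c d : R} (h : c * d = 1) (n : ℕ) :
    ∑ k ∈ Finset.range (n + 1), ((2 * n).choose (n + k) : R) * (c ^ k + d ^ k) =
      ((2 * n).choose n : R) + (c + 2 + d) ^ n := by
  have hexp : (c + 2 + d) ^ n =
      ∑ i ∈ Finset.range (2 * n + 1), c ^ i * d ^ n * ((2 * n).choose i : R) := by
    have h2 : c + 2 + d = (c + 1) ^ 2 * d := by linear_combination (-c - 2) * h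
    rw [h2, mul_pow, ← pow_mul, add_pow, Finset.sum_mul]
    exact Finset.sum_congr rfl fun i _ => by ring
  have hlow : ∑ i ∈ Finset.range n, c ^ i * d ^ n * ((2 * n).choose i : R) =
      ∑ k ∈ Finset.range n, ((2 * n).choose (n + (k + 1)) : R) * d ^ (k + 1) := by
    rw [← Finset.sum_range_reflect]
    refine Finset.sum_congr rfl fun k hk => ?_
    obtain ⟨m, rfl⟩ := Nat.exists_eq_add_of_lt (Finset.mem_range.mp hk)
    rw [show k + m + 1 - 1 - k = m by omega,
      Nat.choose_symm_of_eq_add (show 2 * (k + m + 1) = m + (k + m + 1 + (k + 1)) by omega),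
      show k + m + 1 = m + (k + 1) by omega, pow_add, ← mul_assoc, ← mul_pow, h, one_pow]
    ring
  have hhigh : ∑ k ∈ Finset.range (n + 1),
        c ^ (n + k) * d ^ n * ((2 * n).choose (n + k) : R) =
      ∑ k ∈ Finset.range (n + 1), ((2 * n).choose (n + k) : R) * c ^ k := by
    refine Finset.sum_congr rfl fun k _ => ?_
    have h1 : c ^ n * d ^ n = 1 := by rw [← mul_pow, h, one_pow]
    linear_combination c ^ k * ((2 * n).choose (n + k) : R) * h1
  rw [hexp, show 2 * n + 1 = n + (n + 1) by omega, Finset.sum_range_add _ n (n + 1), hlow, hhigh]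
  simp only [mul_add, Finset.sum_add_distrib]
  rw [Finset.sum_range_succ' (fun k => ((2 * n).choose (n + k) : R) * d ^ k)]
  simp only [add_zero, pow_zero, mul_one]
  ring

theorem sum_range_two_mul_add_one_of_symm {R : Type*} [CommSemiring R] (f : ℕ → R) (r : ℕ)
    (hf : ∀ j < r, f (2 * r - j) = f j) :
    ∑ j ∈ Finset.range (2 * r + 1), f j = 2 * ∑ j ∈ Finset.range r, f j + f r := by
  have hhigh : ∑ k ∈ Finset.range r, f (r + (k + 1)) = ∑ j ∈ Finset.range r, f j := by
    rw [← Finset.sum_range_reflect f]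
    refine Finset.sum_congr rfl fun k hk => ?_
    have := Finset.mem_range.mp hk
    rw [← hf (r - 1 - k) (by omega)]
    congr 1
    omega
  rw [show 2 * r + 1 = r + (r + 1) by omega, Finset.sum_range_add _ r (r + 1), Finset.sum_range_succ', hhigh,
    add_zero]
  ring

theorem two_mul_pow_add_pow_pow {R : Type*} [CommSemiring R] (a b : R) (k m : ℕ) :
    2 * (a ^ k + b ^ k) ^ m =
      ∑ j ∈ Finset.range (m + 1),
        (m.choose j : R) * ((a ^ (m - j) * b ^ j) ^ k + (a ^ j * b ^ (m - j)) ^ k) := by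
  rw [two_mul]
  nth_rewrite 1 [add_comm (a ^ k)]
  rw [add_pow, add_pow, ← Finset.sum_add_distrib]
  refine Finset.sum_congr rfl fun j _ => ?_
  simp only [mul_pow, ← pow_mul, mul_comm k]
  ring

theorem pow_mul_pow_add_two_add {R : Type*} [CommRing R] {a b : R} (hab : a * b = -1) {r j : ℕ}
    (hro : Odd r) (hj : j ≤ r) :
    a ^ (2 * r - j) * b ^ j + 2 + a ^ j * b ^ (2 * r - j) =
      (-1) ^ j * (a ^ (r - j) - b ^ (r - j)) ^ 2 := by
  obtain ⟨m, rfl⟩ := Nat.exists_eq_add_of_le hj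
  have hm : (-1 : R) ^ j * (-1) ^ m = -1 := by rw [← pow_add, hro.neg_one_pow]
  rw [show 2 * (j + m) - j = j + 2 * m by omega, Nat.add_sub_cancel_left]
  have h1 : a ^ j * b ^ j = (-1) ^ j := by rw [← mul_pow, hab]
  have h2 : a ^ m * b ^ m = (-1) ^ m := by rw [← mul_pow, hab]
  rw [pow_add, pow_add, mul_comm 2 m, pow_mul, pow_mul]
  linear_combination ((a ^ m) ^ 2 + (b ^ m) ^ 2) * h1 + 2 * (-1) ^ j * h2 + 2 * hm

/-- Theorem (odd case): for `p ∈ ℂ`, `r` a positive odd integer and `n ≥ 1`,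
`∑_{k=0}^n C(2n, n+k) v_k^{2r}
  = 2^{2r-1} C(2n,n) + (p²+4)^n ∑_{i=0}^{r-1} (-1)^{in} C(2r,i) u_{r-i}^{2n}`. -/
theorem sum_genLucas_pow_odd (p : ℂ) (r : ℕ) (hr : 0 < r) (hro : Odd r)
    (n : ℕ) (hn : 0 < n) :
    ∑ k ∈ Finset.range (n + 1),
        ((Nat.choose (2 * n) (n + k) : ℂ) * genLucas p k ^ (2 * r)) =
      2 ^ (2 * r - 1) * (Nat.choose (2 * n) n : ℂ) +
        (p ^ 2 + 4) ^ n *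
          ∑ i ∈ Finset.range r,
            (-1 : ℂ) ^ (i * n) * (Nat.choose (2 * r) i : ℂ) *
              genFib p (r - i) ^ (2 * n) := by
  obtain ⟨a, b, hp, hab⟩ := exists_add_eq_and_mul_eq_neg_one p
  have hdisc : p ^ 2 + 4 = (a - b) ^ 2 := by rw [← hp]; linear_combination 4 * hab
  set T : ℕ → ℂ := fun j => (a ^ (2 * r - j) * b ^ j + 2 + a ^ j * b ^ (2 * r - j)) ^ n with hT
  have hT_eq (j : ℕ) (hj : j ≤ r) :
      T j = (p ^ 2 + 4) ^ n * ((-1) ^ (j * n) * genFib p (r - j) ^ (2 * n)) := by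
    simp only [hT]
    rw [pow_mul_pow_add_two_add hab hro hj, ← sub_mul_genFib hp hab, hdisc]
    simp only [mul_pow, ← pow_mul]
    ring
  have hT_mid : T r = 0 := by
    rw [hT_eq r le_rfl]
    simp [genFib, hn.ne']
  have hT_symm (j : ℕ) (hj : j < r) :
      ((2 * r).choose (2 * r - j) : ℂ) * T (2 * r - j) = ((2 * r).choose j : ℂ) * T j := by
    simp only [hT]
    rw [Nat.choose_symm (by omega), Nat.sub_sub_self (by omega)]
    ring
  have hinner (j : ℕ) (hj : j ∈ Finset.range (2 * r + 1)) :
      ∑ k ∈ Finset.range (n + 1), ((2 * n).choose (n + k) : ℂ) *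
          ((a ^ (2 * r - j) * b ^ j) ^ k + (a ^ j * b ^ (2 * r - j)) ^ k) =
        ((2 * n).choose n : ℂ) + T j := by
    refine sum_choose_mul_pow_add_pow ?_ n
    have hj' : 2 * r - j + j = 2 * r := by have := Finset.mem_range.mp hj; omega
    calc _ = (a * b) ^ (2 * r - j + j) := by ring
      _ = 1 := by rw [hj', hab, pow_mul]; simp
  have hchoose : ∑ j ∈ Finset.range (2 * r + 1), ((2 * r).choose j : ℂ) = 2 ^ (2 * r) := by
    exact_mod_cast Nat.sum_range_choose (2 * r)
  have htwo : (2 : ℂ) ^ (2 * r) = 2 * 2 ^ (2 * r - 1) := by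
    rw [← pow_succ', Nat.sub_add_cancel (by omega)]
  refine mul_left_cancel₀ (two_ne_zero (α := ℂ)) ?_
  calc
    _ = ∑ k ∈ Finset.range (n + 1), ∑ j ∈ Finset.range (2 * r + 1), ((2 * r).choose j : ℂ) *
          (((2 * n).choose (n + k) : ℂ) *
            ((a ^ (2 * r - j) * b ^ j) ^ k + (a ^ j * b ^ (2 * r - j)) ^ k)) := by
      rw [Finset.mul_sum]
      refine Finset.sum_congr rfl fun k _ => ?_
      rw [genLucas_eq_pow_add_pow hp hab, mul_left_comm, two_mul_pow_add_pow_pow, Finset.mul_sum]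
      exact Finset.sum_congr rfl fun j _ => mul_left_comm _ _ _
    _ = ∑ j ∈ Finset.range (2 * r + 1),
          ((2 * r).choose j : ℂ) * (((2 * n).choose n : ℂ) + T j) := by
      rw [Finset.sum_comm]
      refine Finset.sum_congr rfl fun j hj => ?_
      rw [← Finset.mul_sum, hinner j hj]
    _ = 2 ^ (2 * r) * ((2 * n).choose n : ℂ) +
          2 * ∑ j ∈ Finset.range r, ((2 * r).choose j : ℂ) * T j := by
      simp only [mul_add, Finset.sum_add_distrib]
      rw [← Finset.sum_mul, hchoose,
        sum_range_two_mul_add_one_of_symm (fun j => ((2 * r).choose j : ℂ) * T j) r hT_symm,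
        hT_mid, mul_zero, add_zero]
    _ = _ := by
      rw [htwo, mul_add, mul_assoc, Finset.mul_sum (Finset.range r) _ ((p ^ 2 + 4) ^ n)]
      congr 2
      refine Finset.sum_congr rfl fun j hj => ?_
      rw [hT_eq j (Finset.mem_range.mp hj).le]
      ring
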